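/- arXiv:1310.3013 — 11 statements merged into one kernel-verified Lean document; each statement's English description precedes it below -/
import Mathlib

section
/- Let R be a commutative semiring and M a flat R-module. Then tensoring with M preserves injectivity: for every injective R-linear map f : N → P between R-modules, the induced map id_M ⊗ f : M ⊗[R] N → M ⊗[R] P is injective. -/
open TensorProduct

universe u

/-- A module `M` over a commutative semiring `R` is *flat* if for every pair of `R`-linear
maps `f g : N → P`, the map `M ⊗ E → M ⊗ N` induced by the inclusion of the equalizer
submodule `E = {x ∈ N | f x = g x}` is injective with range the equalizer of
`id_M ⊗ f` and `id_M ⊗ g`. -/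
def Module.IsSemiringFlat (R M : Type u) [CommSemiring R] [AddCommMonoid M]
    [Module R M] : Prop :=
  ∀ (N P : Type u) [AddCommMonoid N] [Module R N] [AddCommMonoid P] [Module R P]
    (f g : N →ₗ[R] P),
    Function.Injective (LinearMap.lTensor M (LinearMap.eqLocus f g).subtype) ∧
      LinearMap.range (LinearMap.lTensor M (LinearMap.eqLocus f g).subtype) =
        LinearMap.eqLocus (LinearMap.lTensor M f) (LinearMap.lTensor M g)

/-- Tensoring with a flat module preserves injectivity. -/
theorem Module.IsSemiringFlat.lTensor_injective (R M : Type u) [CommSemiring R]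
    [AddCommMonoid M] [Module R M] (hM : Module.IsSemiringFlat R M)
    (N P : Type u) [AddCommMonoid N] [Module R N] [AddCommMonoid P] [Module R P]
    (f : N →ₗ[R] P) (hf : Function.Injective f) :
    Function.Injective (LinearMap.lTensor M f) := by
  intro a b hab
  let p := LinearMap.fst R N N
  let q := LinearMap.snd R N N
  let z := LinearMap.lTensor M (LinearMap.inl R N N) a + LinearMap.lTensor M (LinearMap.inr R N N) b
  have hp : LinearMap.lTensor M p z = a := by
    simp [z, p, ← LinearMap.comp_apply, ← LinearMap.lTensor_comp]
  have hq : LinearMap.lTensor M q z = b := by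
    simp [z, q, ← LinearMap.comp_apply, ← LinearMap.lTensor_comp]
  have hz : z ∈ LinearMap.eqLocus (LinearMap.lTensor M (f ∘ₗ p)) (LinearMap.lTensor M (f ∘ₗ q)) := by
    simp only [LinearMap.mem_eqLocus, LinearMap.lTensor_comp, LinearMap.comp_apply, hp, hq, hab]
  rw [← (hM (N × N) P (f ∘ₗ p) (f ∘ₗ q)).2] at hz
  obtain ⟨w, hw⟩ := hz
  have hpq : p ∘ₗ (LinearMap.eqLocus (f ∘ₗ p) (f ∘ₗ q)).subtype =
      q ∘ₗ (LinearMap.eqLocus (f ∘ₗ p) (f ∘ₗ q)).subtype :=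
    LinearMap.ext fun x => hf x.2
  rw [← hp, ← hq, ← hw, ← LinearMap.comp_apply, ← LinearMap.comp_apply, ← LinearMap.lTensor_comp,
    ← LinearMap.lTensor_comp, hpq]
end

section
/- Let A be a commutative semiring, B a commutative A-algebra that is flat as an A-module, and M a B-module that is flat as a B-module. Then M, regarded as an A-module by restriction of scalars along A → B, is flat as an A-module. -/
open TensorProduct

universe u

/-- A flat module preserves every presentation of an equalizer, not only the inclusion of the
equalizer submodule. -/
theorem Module.IsSemiringFlat.lTensor_injective_and_range_eq {R M : Type u} [CommSemiring R]
    [AddCommMonoid M] [Module R M] (h : Module.IsSemiringFlat R M) {E N P : Type u}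
    [AddCommMonoid E] [Module R E] [AddCommMonoid N] [Module R N] [AddCommMonoid P] [Module R P]
    {i : E →ₗ[R] N} {f g : N →ₗ[R] P} (hi : Function.Injective i)
    (hr : LinearMap.range i = LinearMap.eqLocus f g) :
    Function.Injective (LinearMap.lTensor M i) ∧
      LinearMap.range (LinearMap.lTensor M i) =
        LinearMap.eqLocus (LinearMap.lTensor M f) (LinearMap.lTensor M g) := by
  obtain ⟨hinj, hrange⟩ := h N P f g
  let e : E ≃ₗ[R] LinearMap.eqLocus f g :=
    (LinearEquiv.ofInjective i hi).trans (LinearEquiv.ofEq _ _ hr)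
  have hie : i = (LinearMap.eqLocus f g).subtype ∘ₗ e.toLinearMap := rfl
  have hcomp : LinearMap.lTensor M i =
      LinearMap.lTensor M (LinearMap.eqLocus f g).subtype ∘ₗ (e.lTensor M).toLinearMap := by
    conv_lhs => rw [hie, LinearMap.lTensor_comp]
    rfl
  rw [hcomp]
  exact ⟨hinj.comp (e.lTensor M).injective, by rw [LinearEquiv.range_comp, hrange]⟩

/-- The isomorphism `M ⊗[B] (B ⊗[A] N) ≃ M ⊗[A] N` is natural in `N`. -/
theorem TensorProduct.cancelBaseChange_lTensor_baseChange {A B M N P : Type*} [CommSemiring A]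
    [CommSemiring B] [Algebra A B] [AddCommMonoid M] [Module B M] [Module A M]
    [IsScalarTower A B M] [AddCommMonoid N] [Module A N] [AddCommMonoid P] [Module A P]
    (f : N →ₗ[A] P) (z : M ⊗[B] (B ⊗[A] N)) :
    AlgebraTensorModule.cancelBaseChange A B B M P (LinearMap.lTensor M (f.baseChange B) z) =
      LinearMap.lTensor M f (AlgebraTensorModule.cancelBaseChange A B B M N z) := by
  induction z with
  | zero => simp
  | add x y hx hy => simp only [map_add, hx, hy]
  | tmul m y =>
    induction y with
    | zero => simp
    | add x y hx hy => simp only [TensorProduct.tmul_add, map_add, hx, hy]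
    | tmul b n => simp

/-- If `B` is a flat `A`-algebra and `M` is a flat `B`-module, then `M` is flat as an
`A`-module via restriction of scalars along `A → B`. -/
theorem Module.IsSemiringFlat.trans (A B M : Type u) [CommSemiring A] [CommSemiring B]
    [Algebra A B] [AddCommMonoid M] [Module B M] [Module A M] [IsScalarTower A B M]
    (hB : Module.IsSemiringFlat A B) (hM : Module.IsSemiringFlat B M) :
    Module.IsSemiringFlat A M := by
  intro N P _ _ _ _ f g
  let i := (LinearMap.eqLocus f g).subtype
  obtain ⟨hinj, hrange⟩ := hB N P f g
  have hr : LinearMap.range (i.baseChange B) =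
      LinearMap.eqLocus (f.baseChange B) (g.baseChange B) := by
    ext z
    exact SetLike.ext_iff.mp hrange z
  obtain ⟨hinj', hrange'⟩ :=
    hM.lTensor_injective_and_range_eq (i := i.baseChange B) hinj hr
  let eE := AlgebraTensorModule.cancelBaseChange A B B M (LinearMap.eqLocus f g)
  let eN := AlgebraTensorModule.cancelBaseChange A B B M N
  have hnat (w) : eN (LinearMap.lTensor M (i.baseChange B) w) = LinearMap.lTensor M i (eE w) :=
    cancelBaseChange_lTensor_baseChange i w
  constructor
  · intro x y hxy
    obtain ⟨x, rfl⟩ := eE.surjective x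
    obtain ⟨y, rfl⟩ := eE.surjective y
    change LinearMap.lTensor M i (eE x) = LinearMap.lTensor M i (eE y) at hxy
    rw [← hnat, ← hnat] at hxy
    rw [hinj' (eN.injective hxy)]
  · ext z
    obtain ⟨z, rfl⟩ := eN.surjective z
    have hz := SetLike.ext_iff.mp hrange' z
    rw [LinearMap.mem_range, LinearMap.mem_eqLocus] at hz ⊢
    rw [← cancelBaseChange_lTensor_baseChange f z, ← cancelBaseChange_lTensor_baseChange g z,
      (AlgebraTensorModule.cancelBaseChange A B B M P).injective.eq_iff, ← hz,
      eE.surjective.exists]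
    exact exists_congr fun w => by rw [← eN.injective.eq_iff, hnat]
end

section
/- Flatness is preserved under base change: let A be a commutative semiring, M a flat A-module, and B a commutative A-algebra. Then B ⊗[A] M, with its natural B-module structure, is flat as a B-module. -/
open TensorProduct

universe u

/-- The natural additive equivalence `(B ⊗[A] M) ⊗[B] N ≃ M ⊗[A] N` for a `B`-module `N`. -/
noncomputable def TensorProduct.baseChangeCancelLeft (A B M N : Type*) [CommSemiring A]
    [CommSemiring B] [Algebra A B] [AddCommMonoid M] [Module A M] [AddCommMonoid N] [Module A N]
    [Module B N] [IsScalarTower A B N] : (B ⊗[A] M) ⊗[B] N ≃+ M ⊗[A] N :=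
  ((TensorProduct.comm B (B ⊗[A] M) N).toAddEquiv.trans
    (AlgebraTensorModule.cancelBaseChange A B B N M).toAddEquiv).trans
    (TensorProduct.comm A N M).toAddEquiv

theorem TensorProduct.baseChangeCancelLeft_tmul {A B M N : Type*} [CommSemiring A]
    [CommSemiring B] [Algebra A B] [AddCommMonoid M] [Module A M] [AddCommMonoid N] [Module A N]
    [Module B N] [IsScalarTower A B N] (b : B) (m : M) (n : N) :
    baseChangeCancelLeft A B M N ((b ⊗ₜ m) ⊗ₜ n) = m ⊗ₜ (b • n) :=
  rfl

theorem TensorProduct.baseChangeCancelLeft_lTensor {A B M N P : Type*} [CommSemiring A]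
    [CommSemiring B] [Algebra A B] [AddCommMonoid M] [Module A M] [AddCommMonoid N] [Module A N]
    [Module B N] [IsScalarTower A B N] [AddCommMonoid P] [Module A P]
    [Module B P] [IsScalarTower A B P] (f : N →ₗ[B] P) (z : (B ⊗[A] M) ⊗[B] N) :
    baseChangeCancelLeft A B M P (f.lTensor (B ⊗[A] M) z) =
      (f.restrictScalars A).lTensor M (baseChangeCancelLeft A B M N z) := by
  induction z with
  | zero => simp only [map_zero]
  | add x y hx hy => simp only [map_add, hx, hy]
  | tmul x n =>
    induction x with
    | zero => simp only [zero_tmul, map_zero]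
    | add x y hx hy => simp only [add_tmul, map_add, hx, hy]
    | tmul b m =>
      simp only [LinearMap.lTensor_tmul, baseChangeCancelLeft_tmul,
        LinearMap.restrictScalars_apply, map_smul]

/-- Flatness is preserved under base change: if `M` is a flat `A`-module and `B` is a
commutative `A`-algebra, then `B ⊗[A] M` is flat as a `B`-module. -/
theorem Module.IsSemiringFlat.baseChange (A B M : Type u) [CommSemiring A] [CommSemiring B]
    [Algebra A B] [AddCommMonoid M] [Module A M]
    (hM : Module.IsSemiringFlat A M) :
    Module.IsSemiringFlat B (B ⊗[A] M) := by
  intro N P _ _ _ _ f g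
  let _ : Module A N := Module.compHom N (algebraMap A B)
  let _ : Module A P := Module.compHom P (algebraMap A B)
  have : IsScalarTower A B N := IsScalarTower.of_algebraMap_smul fun _ _ => rfl
  have : IsScalarTower A B P := IsScalarTower.of_algebraMap_smul fun _ _ => rfl
  obtain ⟨hinj, hrange⟩ : Function.Injective
        (((LinearMap.eqLocus f g).subtype.restrictScalars A).lTensor M) ∧
      LinearMap.range (((LinearMap.eqLocus f g).subtype.restrictScalars A).lTensor M) =
        LinearMap.eqLocus ((f.restrictScalars A).lTensor M) ((g.restrictScalars A).lTensor M) :=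
    hM N P (f.restrictScalars A) (g.restrictScalars A)
  refine ⟨fun x y hxy => ?_, ?_⟩
  · apply (baseChangeCancelLeft A B M _).injective
    apply hinj
    rw [← baseChangeCancelLeft_lTensor, ← baseChangeCancelLeft_lTensor, hxy]
  · ext z
    rw [LinearMap.mem_eqLocus, ← (baseChangeCancelLeft A B M P).injective.eq_iff,
      baseChangeCancelLeft_lTensor, baseChangeCancelLeft_lTensor, ← LinearMap.mem_eqLocus,
      ← hrange, LinearMap.mem_range, LinearMap.mem_range]
    refine Iff.trans ?_ (baseChangeCancelLeft A B M (LinearMap.eqLocus f g)).surjective.exists.symm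
    simp only [← baseChangeCancelLeft_lTensor, EquivLike.apply_eq_iff_eq]
end

section
/- Let B be a commutative semiring and (C_i)_{i ∈ ι} a faithful family of flat commutative B-algebras. Let f, g : N → P be B-linear maps between B-modules and let h : M → N be a B-linear map satisfying f ∘ h = g ∘ h. Then the following are equivalent: (1) h is injective and its range equals the equalizer {x ∈ N | f x = g x}; (2) for every i ∈ ι, the map id_{C_i} ⊗ h : C_i ⊗[B] M → C_i ⊗[B] N is injective and its range equals {z ∈ C_i ⊗[B] N | (id_{C_i} ⊗ f) z = (id_{C_i} ⊗ g) z}. -/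
open TensorProduct

universe u

/-- A family `(C i)` of `R`-algebras is *faithful* if a map of `R`-modules is bijective
as soon as all the maps obtained by tensoring with the `C i` are bijective. -/
def Algebra.IsFaithfulFamily (R : Type u) [CommSemiring R] {ι : Type u} (C : ι → Type u)
    [∀ i, CommSemiring (C i)] [∀ i, Algebra R (C i)] : Prop :=
  ∀ (M P : Type u) [AddCommMonoid M] [Module R M] [AddCommMonoid P] [Module R P]
    (g : M →ₗ[R] P),
    (∀ i, Function.Bijective (LinearMap.lTensor (C i) g)) → Function.Bijective g

/-- Postcomposing with an injective map `j` turns bijectivity of `k` into injectivity of the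
composite together with equality of its range with that of `j`. -/
theorem LinearMap.injective_and_range_comp_eq_iff_bijective {R M E N : Type*} [Semiring R]
    [AddCommMonoid M] [Module R M] [AddCommMonoid E] [Module R E] [AddCommMonoid N] [Module R N]
    {j : E →ₗ[R] N} (hj : Function.Injective j) (k : M →ₗ[R] E) :
    (Function.Injective (j.comp k) ∧ LinearMap.range (j.comp k) = LinearMap.range j) ↔
      Function.Bijective k := by
  rw [LinearMap.coe_comp, hj.of_comp_iff, Function.Bijective]
  refine and_congr_right fun _ => ⟨fun hr y => ?_, fun hk => ?_⟩
  · obtain ⟨x, hx⟩ : j y ∈ LinearMap.range (j.comp k) := hr ▸ LinearMap.mem_range_self j y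
    exact ⟨x, hj hx⟩
  · exact LinearMap.range_comp_of_range_eq_top j (LinearMap.range_eq_top.2 hk)

/-- Being an equalizer diagram can be checked after tensoring with a faithful family of
flat algebras. -/
theorem equalizer_iff_of_faithful_flat_family (B : Type u) [CommSemiring B]
    {ι : Type u} (C : ι → Type u) [∀ i, CommSemiring (C i)] [∀ i, Algebra B (C i)]
    (hfaith : Algebra.IsFaithfulFamily B C)
    (hflat : ∀ i, Module.IsSemiringFlat B (C i))
    (M N P : Type u) [AddCommMonoid M] [Module B M] [AddCommMonoid N] [Module B N]
    [AddCommMonoid P] [Module B P]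
    (f g : N →ₗ[B] P) (h : M →ₗ[B] N) (hcomp : f.comp h = g.comp h) :
    (Function.Injective h ∧ LinearMap.range h = LinearMap.eqLocus f g) ↔
      ∀ i, Function.Injective (LinearMap.lTensor (C i) h) ∧
        LinearMap.range (LinearMap.lTensor (C i) h) =
          LinearMap.eqLocus (LinearMap.lTensor (C i) f) (LinearMap.lTensor (C i) g) := by
  obtain ⟨k, rfl⟩ : ∃ k : M →ₗ[B] LinearMap.eqLocus f g,
      (LinearMap.eqLocus f g).subtype.comp k = h :=
    ⟨h.codRestrict _ fun x => LinearMap.congr_fun hcomp x, LinearMap.subtype_comp_codRestrict _ _ _⟩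
  have base := LinearMap.injective_and_range_comp_eq_iff_bijective
    (Submodule.subtype_injective (LinearMap.eqLocus f g)) k
  rw [Submodule.range_subtype] at base
  rw [base]
  have tensored (i : ι) := LinearMap.injective_and_range_comp_eq_iff_bijective
    (hflat i N P f g).1 (k.lTensor (C i))
  simp only [(hflat _ N P f g).2, ← LinearMap.lTensor_comp] at tensored
  simp only [tensored]
  exact ⟨fun hk i => ((LinearEquiv.ofBijective k hk).lTensor (C i)).bijective, hfaith _ _ k⟩
end

section
/- Let A be a zerosumfree commutative semiring, i.e., for all x, y ∈ A, x + y = 0 implies x = 0. Let M be a flat A-module in which every element has an additive inverse (for every m ∈ M there exists m' ∈ M with m + m' = 0). Then M is trivial: M has exactly one element. In particular, zero is the only flat A-module that is a group under addition. -/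
open TensorProduct

universe u

/-- Over a zerosumfree commutative semiring, the zero module is the only flat module
that is a group under addition. -/
theorem subsingleton_of_flat_of_addGroup (A M : Type u) [CommSemiring A]
    (hzsf : ∀ x y : A, x + y = 0 → x = 0)
    [AddCommMonoid M] [Module A M]
    (hflat : Module.IsSemiringFlat A M)
    (hinv : ∀ m : M, ∃ m' : M, m + m' = 0) :
    Subsingleton M := by
  let f : A × A →ₗ[A] A := LinearMap.coprod LinearMap.id LinearMap.id
  have hE : ∀ x : LinearMap.eqLocus f 0, x = 0 := by
    rintro ⟨⟨a, b⟩, h⟩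
    have hab : a + b = 0 := h
    exact Subtype.ext (Prod.ext (hzsf a b hab) (hzsf b a (by rwa [add_comm])))
  have : Subsingleton (LinearMap.eqLocus f 0) := ⟨fun x y => (hE x).trans (hE y).symm⟩
  have hM : ∀ m : M, m = 0 := by
    intro m
    obtain ⟨m', hm⟩ := hinv m
    have hz : m ⊗ₜ[A] ((1, 0) : A × A) + m' ⊗ₜ[A] ((0, 1) : A × A) ∈
        LinearMap.eqLocus (LinearMap.lTensor M f) (LinearMap.lTensor M 0) := by
      simp [LinearMap.mem_eqLocus, f, ← TensorProduct.add_tmul, hm]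
    rw [← (hflat (A × A) A f 0).2] at hz
    obtain ⟨w, hw⟩ := hz
    rw [Subsingleton.elim w 0, map_zero] at hw
    simpa using congrArg
      (TensorProduct.rid A M ∘ LinearMap.lTensor M (LinearMap.fst A A A)) hw.symm
  exact ⟨fun x y => (hM x).trans (hM y).symm⟩
end

section
/- Let A be a commutative semiring and M an A-module. Regard A ⊗[ℕ] ℤ as an A-module via the left tensor factor (a • (b ⊗ n) = (a·b) ⊗ n). Then the evaluation map Φ from the A-module of A-linear maps Hom_A(A ⊗[ℕ] ℤ, M) to M given by Φ(f) = f(1 ⊗ 1) is injective, and its range is exactly the set V(M) = {m ∈ M | ∃ m' ∈ M, m + m' = 0} of additively invertible elements of M. Thus V(M) ≅ Hom_A(A ⊗[ℕ] ℤ, M). -/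
open TensorProduct

universe u

/-- The additively invertible elements of an `A`-module `M` are exactly the values at
`1 ⊗ 1` of `A`-linear maps `A ⊗[ℕ] ℤ → M`, and such a map is determined by this value;
that is, `V(M) ≅ Hom_A(A ⊗[ℕ] ℤ, M)`. -/
theorem additivelyInvertible_eq_range_eval (A M : Type u) [CommSemiring A]
    [AddCommMonoid M] [Module A M] :
    Function.Injective
        (fun f : (A ⊗[ℕ] ℤ) →ₗ[A] M => f ((1 : A) ⊗ₜ[ℕ] (1 : ℤ))) ∧
      Set.range (fun f : (A ⊗[ℕ] ℤ) →ₗ[A] M => f ((1 : A) ⊗ₜ[ℕ] (1 : ℤ))) =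
        {m : M | ∃ m' : M, m + m' = 0} := by
  refine ⟨fun f g h => ?_, Set.ext fun m => ⟨?_, ?_⟩⟩
  · have key : (f.toAddMonoidHom.comp (TensorProduct.mk ℕ A ℤ 1).toAddMonoidHom) =
        g.toAddMonoidHom.comp (TensorProduct.mk ℕ A ℤ 1).toAddMonoidHom :=
      AddMonoidHom.ext_int h
    refine TensorProduct.AlgebraTensorModule.ext fun a n => ?_
    have hn : f (1 ⊗ₜ n) = g (1 ⊗ₜ n) := DFunLike.congr_fun key n
    have ha : a ⊗ₜ[ℕ] n = a • ((1 : A) ⊗ₜ[ℕ] n) := by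
      rw [TensorProduct.smul_tmul', smul_eq_mul, mul_one]
    rw [ha, map_smul, map_smul, hn]
  · rintro ⟨f, rfl⟩
    refine ⟨f (1 ⊗ₜ (-1)), ?_⟩
    rw [← map_add, ← TensorProduct.tmul_add, add_neg_cancel, TensorProduct.tmul_zero, map_zero]
  · rintro ⟨m', hm⟩
    let u : AddUnits M := ⟨m, m', hm, by rwa [add_comm]⟩
    let g : ℤ →ₗ[ℕ] M := ((AddUnits.coeHom M).comp (zmultiplesHom (AddUnits M) u)).toNatLinearMap
    refine ⟨TensorProduct.AlgebraTensorModule.lift (LinearMap.toSpanSingleton A (ℤ →ₗ[ℕ] M) g), ?_⟩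
    simp [g, u]
end

section
/- Let s be a multiset of real numbers all of which are nonnegative. Then for every natural number n ≥ 1, one has (n : ℝ) * esymm s n ≤ esymm s 1 * esymm s (n − 1), where esymm s n denotes the n-th elementary symmetric function of s. (This expresses the nonnegativity of the monomial symmetric function m_{2,1^{n−2}} = e_{n−1}·e₁ − n·e_n evaluated at nonnegative reals.) -/
theorem Multiset.esymm_cons_succ {R : Type*} [CommSemiring R] (a : R) (s : Multiset R) (n : ℕ) :
    (a ::ₘ s).esymm (n + 1) = s.esymm (n + 1) + a * s.esymm n := by
  simp [Multiset.esymm, Multiset.sum_map_mul_left]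

theorem Multiset.esymm_nonneg {R : Type*} [CommSemiring R] [PartialOrder R] [IsOrderedRing R]
    {s : Multiset R} (hs : ∀ x ∈ s, 0 ≤ x) (n : ℕ) : 0 ≤ s.esymm n := by
  refine Multiset.sum_nonneg fun y hy => ?_
  obtain ⟨t, ht, rfl⟩ := Multiset.mem_map.1 hy
  exact Multiset.prod_nonneg fun x hx =>
    hs x (Multiset.mem_of_le (Multiset.mem_powersetCard.1 ht).1 hx)

/-- Nonnegativity of the monomial symmetric function `m_{2,1^(n-2)} = e_{n-1}·e₁ − n·e_n`
evaluated at nonnegative reals: `n · eₙ(s) ≤ e₁(s) · e_{n−1}(s)`. -/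
theorem esymm_mul_le (s : Multiset ℝ) (hs : ∀ x ∈ s, 0 ≤ x) (n : ℕ) (hn : 1 ≤ n) :
    (n : ℝ) * s.esymm n ≤ s.esymm 1 * s.esymm (n - 1) := by
  obtain ⟨m, rfl⟩ := Nat.exists_eq_add_of_le' hn
  rw [Nat.add_sub_cancel]
  clear hn
  induction s using Multiset.induction generalizing m with
  | empty => simp [Multiset.esymm, Multiset.powersetCard_zero_right]
  | cons a t ih =>
    have ha : 0 ≤ a := hs a (Multiset.mem_cons_self a t)
    have ht : ∀ x ∈ t, 0 ≤ x := fun x hx => hs x (Multiset.mem_cons_of_mem hx)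
    have h_zero (u : Multiset ℝ) : u.esymm 0 = 1 := by simp [Multiset.esymm]
    cases m with
    | zero => simp [h_zero]
    | succ k =>
      have h_upper := ih ht (k + 1)
      have h_lower := mul_le_mul_of_nonneg_left (ih ht k) ha
      have h_sq := mul_nonneg (mul_nonneg ha ha) (Multiset.esymm_nonneg ht k)
      have h_one : (a ::ₘ t).esymm 1 = t.esymm 1 + a := by
        simpa [h_zero] using Multiset.esymm_cons_succ a t 0
      rw [h_one, Multiset.esymm_cons_succ, Multiset.esymm_cons_succ]
      push_cast at h_upper h_lower ⊢
      linarith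
end

section
/- Let s be a multiset of real numbers all of which are nonnegative. Then for every natural number n, one has (n! : ℝ) * esymm s n ≤ (esymm s 1)^n, where esymm s n denotes the n-th elementary symmetric function of s. Equivalently, for a real polynomial ∏_{α ∈ s}(1 + α t) = 1 + a₁ t + a₂ t² + ⋯ with all α ≥ 0, the coefficients satisfy a_n ≤ a₁ⁿ/n!. -/
theorem Multiset.esymm_one_eq_sum {R : Type*} [CommSemiring R] (s : Multiset R) :
    s.esymm 1 = s.sum := by
  simp [Multiset.esymm, Multiset.powersetCard_one]

/-- The first two terms of the binomial expansion bound a power of a sum of nonnegatives. -/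
theorem pow_succ_add_mul_le_add_pow {a b : ℝ} (ha : 0 ≤ a) (hb : 0 ≤ b) (n : ℕ) :
    a ^ (n + 1) + (n + 1) * (b * a ^ n) ≤ (a + b) ^ (n + 1) := by
  induction n with
  | zero => simp
  | succ n ih =>
    have h : 0 ≤ (n + 1) * (b ^ 2 * a ^ n) := by positivity
    calc a ^ (n + 1 + 1) + ((n + 1 : ℕ) + 1) * (b * a ^ (n + 1))
        ≤ (a ^ (n + 1) + (n + 1) * (b * a ^ n)) * (a + b) := by
          push_cast
          linear_combination h
      _ ≤ (a + b) ^ (n + 1) * (a + b) := by gcongr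
      _ = (a + b) ^ (n + 1 + 1) := (pow_succ _ _).symm

/-- For a multiset `s` of nonnegative reals, the coefficients `aₙ = eₙ(s)` of
`∏_{α ∈ s} (1 + α t)` satisfy `aₙ ≤ a₁ⁿ / n!`, i.e. `n! · eₙ(s) ≤ (e₁ s)ⁿ`. -/
theorem factorial_mul_esymm_le (s : Multiset ℝ) (hs : ∀ x ∈ s, 0 ≤ x) (n : ℕ) :
    (n.factorial : ℝ) * s.esymm n ≤ s.esymm 1 ^ n := by
  rw [Multiset.esymm_one_eq_sum]
  induction s using Multiset.induction_on generalizing n with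
  | empty => cases n <;> simp [Multiset.esymm, Multiset.powersetCard_zero_right]
  | cons a s ih =>
    have ha : 0 ≤ a := hs a (Multiset.mem_cons_self a s)
    have hs' : ∀ x ∈ s, 0 ≤ x := fun x hx => hs x (Multiset.mem_cons_of_mem hx)
    cases n with
    | zero => simp [Multiset.esymm]
    | succ n =>
      rw [Multiset.esymm_cons_succ, Multiset.sum_cons, add_comm a]
      calc ((n + 1).factorial : ℝ) * (s.esymm (n + 1) + a * s.esymm n)
          = (n + 1).factorial * s.esymm (n + 1)
              + (n + 1) * (a * (n.factorial * s.esymm n)) := by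
            rw [Nat.factorial_succ]
            push_cast
            ring
        _ ≤ s.sum ^ (n + 1) + (n + 1) * (a * s.sum ^ n) := by
            gcongr
            · exact ih hs' (n + 1)
            · exact ih hs' n
        _ ≤ (s.sum + a) ^ (n + 1) :=
            pow_succ_add_mul_le_add_pow (Multiset.sum_nonneg hs') ha n
end

section
/- Let a : ℕ → ℤ be a sequence of integers with a 0 = 1, with 0 ≤ a n for all n, and such that for every n ≥ 1 one has (n : ℤ) * a n ≤ a 1 * a (n − 1). Then a n = 0 for all sufficiently large n; that is, there exists N such that a n = 0 for all n ≥ N. (Hence an integer power series whose coefficients satisfy these positivity conditions is a polynomial.) -/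
/-- A sequence of nonnegative integers with `a 0 = 1` satisfying the coefficient bound
`n · a n ≤ a 1 · a (n−1)` is eventually zero; hence an integer power series whose
coefficients satisfy these positivity conditions is a polynomial. -/
theorem eventually_zero_of_coeff_bound (a : ℕ → ℤ) (h0 : a 0 = 1)
    (hpos : ∀ n : ℕ, 0 ≤ a n)
    (hbound : ∀ n : ℕ, 1 ≤ n → (n : ℤ) * a n ≤ a 1 * a (n - 1)) :
    ∃ N : ℕ, ∀ n : ℕ, N ≤ n → a n = 0 := by
  obtain ⟨M, hM⟩ := Int.eq_ofNat_of_zero_le (hpos 1)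
  have descent : ∀ k : ℕ, a (M + k) = 0 ∨ a (M + k) + k ≤ a M := by
    intro k
    induction k with
    | zero => right; simp
    | succ k ih =>
      have hb := hbound (M + k + 1) (by omega)
      rw [hM, Nat.add_sub_cancel] at hb
      push_cast at hb
      rw [← add_assoc]
      push_cast
      rcases (hpos (M + k + 1)).eq_or_lt with hz | hlt
      · exact Or.inl hz.symm
      · right
        have hdec : a (M + k + 1) < a (M + k) := by
          by_contra! hle
          have hmul : (M : ℤ) * a (M + k) ≤ M * a (M + k + 1) := by gcongr
          have hk : (0 : ℤ) ≤ k * a (M + k + 1) := by positivity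
          linarith
        rcases ih with ih | ih <;> omega
  refine ⟨M + (a M).toNat, fun n hn => ?_⟩
  obtain ⟨k, rfl⟩ := Nat.exists_eq_add_of_le (show M ≤ n by omega)
  have hk := hpos (M + k)
  have hM0 := hpos M
  rcases descent k with h | h <;> omega
end

section
/- Fix a prime p and a natural number k. Let σ = {(i,j) ∈ ℕ × ℕ | i + j ≤ k}, let R = MvPolynomial σ ℚ, and let I be the ideal of R generated by the elements X_{(i,j)}^p − X_{(i+1,j)} − p·X_{(i,j+1)} for all (i,j) with i + j ≤ k − 1. Then the ℚ-algebra homomorphism from MvPolynomial (Fin (k+1)) ℚ to R/I sending the i-th variable to the residue class of X_{(i,0)} is bijective; that is, R/I is a polynomial ℚ-algebra freely generated by the images of X_{(0,0)}, X_{(1,0)}, …, X_{(k,0)}. -/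
open MvPolynomial

/-- The polynomial in the variables `X_(0,0), …, X_(k,0)` to which solving the relations
`X_(i,j)^p = X_(i+1,j) + p·X_(i,j+1)` for `X_(i,j+1)` reduces `X_(i,j)`. -/
noncomputable def wittReduction (p k : ℕ) : ℕ → ℕ → MvPolynomial (Fin (k + 1)) ℚ
  | i, 0 => if h : i < k + 1 then X ⟨i, h⟩ else 0
  | i, j + 1 => C (p : ℚ)⁻¹ * (wittReduction p k i j ^ p - wittReduction p k (i + 1) j)

theorem natCast_mul_wittReduction_succ {p : ℕ} (k : ℕ) (hp : p ≠ 0) (i j : ℕ) :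
    (p : MvPolynomial (Fin (k + 1)) ℚ) * wittReduction p k i (j + 1) =
      wittReduction p k i j ^ p - wittReduction p k (i + 1) j := by
  have hp' : (p : ℚ) ≠ 0 := Nat.cast_ne_zero.mpr hp
  rw [wittReduction, ← mul_assoc, ← map_natCast (C : ℚ →+* MvPolynomial (Fin (k + 1)) ℚ) p,
    ← C_mul, mul_inv_cancel₀ hp', C_1, one_mul]

/-- If a subalgebra of a `ℚ`-algebra contains all `x i 0` with `i ≤ k`, and `x` satisfies
`x i j ^ p = x (i + 1) j + p * x i (j + 1)` for `i + j + 1 ≤ k`, then it contains all `x i j` with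
`i + j ≤ k`. -/
theorem Subalgebra.mem_of_pow_eq_add_natCast_mul {A : Type*} [CommRing A] [Algebra ℚ A]
    (S : Subalgebra ℚ A) {p k : ℕ} (hp : p ≠ 0) (x : (i j : ℕ) → i + j ≤ k → A)
    (hx : ∀ (i j : ℕ) (h : i + j ≤ k) (h₁ : i + 1 + j ≤ k) (h₂ : i + (j + 1) ≤ k),
      x i j h ^ p = x (i + 1) j h₁ + (p : A) * x i (j + 1) h₂)
    (h0 : ∀ (i : ℕ) (h : i + 0 ≤ k), x i 0 h ∈ S) (i j : ℕ) (h : i + j ≤ k) :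
    x i j h ∈ S := by
  have hp' : (p : ℚ) ≠ 0 := Nat.cast_ne_zero.mpr hp
  induction j generalizing i with
  | zero => exact h0 i h
  | succ j ih =>
    have h₀ : i + j ≤ k := by omega
    have h₁ : i + 1 + j ≤ k := by omega
    have key : x i (j + 1) h = (p : ℚ)⁻¹ • (x i j h₀ ^ p - x (i + 1) j h₁) := by
      rw [hx i j h₀ h₁ h, add_sub_cancel_left, ← nsmul_eq_mul, ← Nat.cast_smul_eq_nsmul ℚ,
        inv_smul_smul₀ hp']
    rw [key]
    exact S.smul_mem (S.sub_mem (S.pow_mem (ih i h₀) p) (ih (i + 1) h₁)) _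

/-- If an ideal contains the differences of the relations
`X_(i,j)^p = X_(i+1,j) + p·X_(i,j+1)`, then the classes of the `X_(i,0)` generate the quotient. -/
theorem aeval_surjective_of_pow_sub_mem {p k : ℕ}
    (I : Ideal (MvPolynomial {q : ℕ × ℕ // q.1 + q.2 ≤ k} ℚ)) (hp : p ≠ 0)
    (hI : ∀ (i j : ℕ) (h : i + j ≤ k) (h₁ : i + 1 + j ≤ k) (h₂ : i + (j + 1) ≤ k),
      (X ⟨(i, j), h⟩ ^ p - X ⟨(i + 1, j), h₁⟩ -
        (p : MvPolynomial {q : ℕ × ℕ // q.1 + q.2 ≤ k} ℚ) * X ⟨(i, j + 1), h₂⟩) ∈ I)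
    (y : Fin (k + 1) → MvPolynomial {q : ℕ × ℕ // q.1 + q.2 ≤ k} ℚ ⧸ I)
    (hy : ∀ (i : Fin (k + 1)) (h : i.1 + 0 ≤ k), y i = Ideal.Quotient.mk I (X ⟨(i.1, 0), h⟩)) :
    Function.Surjective (aeval (R := ℚ) y) := by
  have hmem := Subalgebra.mem_of_pow_eq_add_natCast_mul (aeval (R := ℚ) y).range hp
    (fun i j h => Ideal.Quotient.mk I (X ⟨(i, j), h⟩))
    (fun i j h h₁ h₂ => by
      rw [← map_pow, ← map_natCast (Ideal.Quotient.mk I), ← map_mul, ← map_add,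
        Ideal.Quotient.eq, ← sub_sub]
      exact hI i j h h₁ h₂)
    (fun i h => ⟨X ⟨i, Nat.lt_succ_of_le h⟩, (aeval_X _ _).trans (hy _ h)⟩)
  rw [← AlgHom.range_eq_top, eq_top_iff]
  rintro z -
  obtain ⟨f, rfl⟩ := Ideal.Quotient.mk_surjective z
  induction f using MvPolynomial.induction_on with
  | C a => exact Subalgebra.algebraMap_mem _ a
  | add f g hf hg => rw [map_add]; exact add_mem hf hg
  | mul_X f q hf =>
    rw [map_mul]
    exact mul_mem hf (hmem q.1.1 q.1.2 q.2)

/-- Rationally, the quotient of `ℚ[X_{(i,j)} : i+j ≤ k]` by the ideal generated by the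
relations `X_{(i,j)}^p − X_{(i+1,j)} − p·X_{(i,j+1)}` (for `i + j ≤ k − 1`) is a polynomial
algebra freely generated by the classes of `X_{(0,0)}, …, X_{(k,0)}`. -/
theorem wittRationalQuotient_polynomial (p k : ℕ) (hp : p.Prime) :
    Function.Bijective
      (MvPolynomial.aeval
        (fun i : Fin (k + 1) =>
          Ideal.Quotient.mk
            (Ideal.span
              {f : MvPolynomial {q : ℕ × ℕ // q.1 + q.2 ≤ k} ℚ |
                ∃ (i j : ℕ) (h : i + j < k),
                  f = X (⟨(i, j), by omega⟩ : {q : ℕ × ℕ // q.1 + q.2 ≤ k}) ^ p -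
                      X (⟨(i + 1, j), by omega⟩ : {q : ℕ × ℕ // q.1 + q.2 ≤ k}) -
                      (p : MvPolynomial {q : ℕ × ℕ // q.1 + q.2 ≤ k} ℚ) *
                        X (⟨(i, j + 1), by omega⟩ : {q : ℕ × ℕ // q.1 + q.2 ≤ k})})
            (X (⟨(i.1, 0), by have := i.isLt; omega⟩ : {q : ℕ × ℕ // q.1 + q.2 ≤ k}))) :
        MvPolynomial (Fin (k + 1)) ℚ →ₐ[ℚ] _) := by
  have hp0 := hp.ne_zero
  constructor
  · refine Function.LeftInverse.injective
      (g := Ideal.Quotient.liftₐ _ (aeval fun q => wittReduction p k q.1.1 q.1.2) ?_) ?_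
    · intro a ha
      rw [← RingHom.mem_ker]
      refine (Ideal.span_le.mpr ?_) ha
      rintro _ ⟨i, j, h, rfl⟩
      simp [natCast_mul_wittReduction_succ k hp0]
    · intro f
      rw [← AlgHom.comp_apply]
      conv_rhs => rw [← AlgHom.id_apply (R := ℚ) f]
      congr 1
      ext1 i
      rw [AlgHom.comp_apply, aeval_X]
      exact (aeval_X (R := ℚ) _ _).trans (dif_pos i.isLt)
  · refine aeval_surjective_of_pow_sub_mem _ hp0 (fun i j _ _ h₂ => ?_) _ fun _ _ => rfl
    exact Ideal.subset_span ⟨i, j, h₂, rfl⟩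
end

section
/- Let p be a prime number and R a commutative ring. For all p-typical Witt vectors a, b ∈ W(R), the first coefficient of their sum is given by (a + b).coeff 1 = a.coeff 1 + b.coeff 1 − ∑_{i=1}^{p−1} (C(p,i)/p) · (a.coeff 0)^i · (b.coeff 0)^{p−i}, where for 1 ≤ i ≤ p−1 the integer C(p,i)/p = p.choose i / p (exact division, since p divides the binomial coefficient C(p,i)) is mapped into R via the canonical map ℕ → R. Moreover (a + b).coeff 0 = a.coeff 0 + b.coeff 0. -/
open Finset in
/-- Expansion of `(x + y) ^ p` with the factor `p` extracted from the middle terms. -/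
theorem add_pow_prime_eq_choose_div {S : Type*} [CommRing S] {p : ℕ} (hp : p.Prime) (x y : S) :
    (x + y) ^ p = x ^ p + y ^ p +
      p * ∑ i ∈ Ico 1 p, ((p.choose i / p : ℕ) : S) * x ^ i * y ^ (p - i) := by
  have hmid : ∑ i ∈ Ico 1 p, x ^ i * y ^ (p - i) * (p.choose i : S) =
      p * ∑ i ∈ Ico 1 p, ((p.choose i / p : ℕ) : S) * x ^ i * y ^ (p - i) := by
    rw [mul_sum]
    refine sum_congr rfl fun i hi => ?_
    obtain ⟨h1, hlt⟩ := mem_Ico.mp hi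
    have hdvd : p ∣ p.choose i := hp.dvd_choose_self (by omega) hlt
    have hcast : (p.choose i : S) = p * ((p.choose i / p : ℕ) : S) := by
      rw [← Nat.cast_mul, Nat.mul_div_cancel' hdvd]
    rw [hcast]
    ring
  rw [add_pow, sum_range_succ, range_eq_Ico, sum_eq_sum_Ico_succ_bot hp.pos, hmid]
  simp
  ring

namespace WittVector

theorem ghostComponent_one_apply {p : ℕ} [Fact p.Prime] {S : Type*} [CommRing S]
    (x : WittVector p S) :
    ghostComponent 1 x = x.coeff 0 ^ p + p * x.coeff 1 := by
  simp [ghostComponent_apply, wittPolynomial_one, add_comm]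

theorem add_coeff_one_of_isLeftRegular {p : ℕ} [hp : Fact p.Prime] {S : Type*} [CommRing S]
    (hreg : IsLeftRegular (p : S)) (x y : WittVector p S) :
    (x + y).coeff 1 = x.coeff 1 + y.coeff 1 -
      ∑ i ∈ Finset.Ico 1 p,
        ((p.choose i / p : ℕ) : S) * x.coeff 0 ^ i * y.coeff 0 ^ (p - i) := by
  have h := map_add (ghostComponent (p := p) (R := S) 1) x y
  simp only [ghostComponent_one_apply, add_coeff_zero] at h
  rw [add_pow_prime_eq_choose_div hp.out] at h
  apply hreg
  linear_combination h

end WittVector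

/-- The coefficient formulas for the sum of two `p`-typical Witt vectors:
`(a + b).coeff 1 = a.coeff 1 + b.coeff 1 − ∑_{i=1}^{p−1} (C(p,i)/p) a₀^i b₀^(p−i)` and
`(a + b).coeff 0 = a.coeff 0 + b.coeff 0`. -/
theorem wittVector_add_coeff (p : ℕ) [hp : Fact p.Prime] (R : Type*) [CommRing R]
    (a b : WittVector p R) :
    (a + b).coeff 1 =
        a.coeff 1 + b.coeff 1 -
          ∑ i ∈ Finset.Ico 1 p,
            ((p.choose i / p : ℕ) : R) * a.coeff 0 ^ i * b.coeff 0 ^ (p - i) ∧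
      (a + b).coeff 0 = a.coeff 0 + b.coeff 0 := by
  refine ⟨?_, WittVector.add_coeff_zero a b⟩
  let A : WittVector p (MvPolynomial (Fin 2 × ℕ) ℤ) := .mk p fun n => .X (0, n)
  let B : WittVector p (MvPolynomial (Fin 2 × ℕ) ℤ) := .mk p fun n => .X (1, n)
  let f : MvPolynomial (Fin 2 × ℕ) ℤ →+* R :=
    MvPolynomial.eval₂Hom (Int.castRingHom R) fun k => ![a.coeff, b.coeff] k.1 k.2
  have hA : WittVector.map f A = a := by
    ext n
    simp [A, f, WittVector.map_coeff]
  have hB : WittVector.map f B = b := by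
    ext n
    simp [B, f, WittVector.map_coeff]
  have hreg : IsLeftRegular (p : MvPolynomial (Fin 2 × ℕ) ℤ) :=
    (IsRegular.of_ne_zero (Nat.cast_ne_zero.mpr hp.out.ne_zero)).left
  have h := congrArg f (WittVector.add_coeff_one_of_isLeftRegular hreg A B)
  simp only [← WittVector.map_coeff, map_sub, map_add, map_sum, map_mul, map_pow, map_natCast,
    hA, hB] at h
  exact h
end
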